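/- Assume char k = 2. Let ∂ be a link-graded derivation on A and let ε₁, ε₂, ε₃ : A → k be k-algebra homomorphisms. Suppose d : P → kˣ and ε₂(ι x) = d(c x)·d(r x)⁻¹·ε₁(ι x) for all x ∈ S, and suppose K is a dga homotopy from ε₂ to ε₃. Let K'' be the unique (ε₁,ε₃)-twisted derivation with K''(ι x) = d(r x)·K(ι x) for all x ∈ S. Then K'' is a dilated augmentation homotopy from ε₁ to ε₃ with dilating tuple d, i.e., d(c x)·ε₁(ι x) + d(r x)·ε₃(ι x) = K''(∂(ι x)) for all x ∈ S. (The composition of a dilation followed by a dga homotopy is a dilated augmentation homotopy.) -/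

import Mathlib

/-- The monomial `w y := ι y₁ * ⋯ * ι y_m ∈ FreeAlgebra k S` associated to a list `y`,
with `w [] = 1`. -/
def FreeAlgebra.word (k : Type*) [CommSemiring k] {S : Type*} (y : List S) :
    FreeAlgebra k S :=
  (y.map (FreeAlgebra.ι k)).prod

/-- A list `[y₁, …, y_m]` is composable (w.r.t. `c r : S → P`) if `c (y_l) = r (y_{l+1})`
for all `1 ≤ l < m`; the empty list is composable. -/
def Composable {S P : Type*} (c r : S → P) (y : List S) : Prop :=
  List.Chain' (fun a b => c a = r b) y

/-- The set of monomials `w y` over composable lists `y` whose endpoints are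
`(c x, r x)`: for nonempty `y` this means `c (y.getLast) = c x` and `r (y.head) = r x`;
the empty list has endpoints `(p, p)` for every `p`, hence qualifies iff `c x = r x`. -/
def linkMonomials (k : Type*) [CommSemiring k] {S P : Type*} (c r : S → P) (x : S) :
    Set (FreeAlgebra k S) :=
  {a | ∃ y : List S, Composable c r y ∧
    ((∃ h : y ≠ [], c (y.getLast h) = c x ∧ r (y.head h) = r x) ∨
      (y = [] ∧ c x = r x)) ∧
    a = FreeAlgebra.word k y}

/-- A twisted derivation vanishes at `1`. -/
theorem twistedDerivation_one {k A : Type*} [CommRing k] [Ring A] [Algebra k A]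
    (ε₁ ε₂ : A →ₐ[k] k) (K : A →ₗ[k] k)
    (hK : ∀ a b : A, K (a * b) = K a * ε₂ b + ε₁ a * K b) : K 1 = 0 := by
  simpa using hK 1 1

/-- If `ε₂` is the dilation of `ε₁` by `d`, then an `(ε₁,ε₃)`-twisted derivation which agrees on
generators with the row-rescaling of an `(ε₂,ε₃)`-twisted derivation does so on every
composable word. -/
theorem twistedDerivation_word_of_dilation {k S P : Type*} [Field k] {c r : S → P}
    {ε₁ ε₂ ε₃ : FreeAlgebra k S →ₐ[k] k} {d : P → kˣ}
    (hε₂ : ∀ x : S, ε₂ (FreeAlgebra.ι k x) =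
      (d (c x) : k) * ((d (r x) : k))⁻¹ * ε₁ (FreeAlgebra.ι k x))
    {K K'' : FreeAlgebra k S →ₗ[k] k}
    (hK : ∀ a b : FreeAlgebra k S, K (a * b) = K a * ε₃ b + ε₂ a * K b)
    (hK'' : ∀ a b : FreeAlgebra k S, K'' (a * b) = K'' a * ε₃ b + ε₁ a * K'' b)
    (hgen : ∀ x : S, K'' (FreeAlgebra.ι k x) = (d (r x) : k) * K (FreeAlgebra.ι k x))
    (a : S) (t : List S) (ht : Composable c r (a :: t)) :
    K'' (FreeAlgebra.word k (a :: t)) = (d (r a) : k) * K (FreeAlgebra.word k (a :: t)) := by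
  have word_cons (b : S) (l : List S) :
      FreeAlgebra.word k (b :: l) = FreeAlgebra.ι k b * FreeAlgebra.word k l := by
    simp [FreeAlgebra.word]
  induction t generalizing a with
  | nil => simpa [FreeAlgebra.word] using hgen a
  | cons b t ih =>
    obtain ⟨hab, hbt⟩ := List.isChain_cons_cons.mp ht
    have hne : (d (r a) : k) ≠ 0 := (d (r a)).ne_zero
    rw [word_cons a, hK, hK'', ih b hbt, hgen, hε₂, hab]
    field_simp

/-- `char k = 2`. Let `D` be a link-graded derivation on
`A := FreeAlgebra k S` and `ε₁ ε₂ ε₃ : A → k` be `k`-algebra homomorphisms. Suppose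
`d : P → kˣ` and `ε₂ (ι x) = d (c x) * (d (r x))⁻¹ * ε₁ (ι x)` for all `x`, and suppose
`K` is a dga homotopy from `ε₂` to `ε₃` (an `(ε₂,ε₃)`-twisted derivation with
`ε₂ (ι x) + ε₃ (ι x) = K (D (ι x))`). Let `K''` be the unique `(ε₁,ε₃)`-twisted
derivation with `K'' (ι x) = d (r x) * K (ι x)`. Then `K''` is a dilated augmentation
homotopy from `ε₁` to `ε₃` with dilating tuple `d`:
`d (c x) * ε₁ (ι x) + d (r x) * ε₃ (ι x) = K'' (D (ι x))` for all `x`. -/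
theorem dilation_then_dga_homotopy
    (k : Type*) [Field k] [CharP k 2] (S P : Type*) (c r : S → P)
    (D : FreeAlgebra k S →ₗ[k] FreeAlgebra k S)
    (hLeibniz : ∀ a b : FreeAlgebra k S, D (a * b) = D a * b + a * D b)
    (hgraded : ∀ x : S,
      D (FreeAlgebra.ι k x) ∈ Submodule.span k (linkMonomials k c r x))
    (ε₁ ε₂ ε₃ : FreeAlgebra k S →ₐ[k] k)
    (d : P → kˣ)
    (hε₂ : ∀ x : S, ε₂ (FreeAlgebra.ι k x) =
      (d (c x) : k) * ((d (r x) : k))⁻¹ * ε₁ (FreeAlgebra.ι k x))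
    (K : FreeAlgebra k S →ₗ[k] k)
    (hKtw : ∀ a b : FreeAlgebra k S, K (a * b) = K a * ε₃ b + ε₂ a * K b)
    (hKhtp : ∀ x : S,
      ε₂ (FreeAlgebra.ι k x) + ε₃ (FreeAlgebra.ι k x) = K (D (FreeAlgebra.ι k x)))
    (K'' : FreeAlgebra k S →ₗ[k] k)
    (hK''tw : ∀ a b : FreeAlgebra k S, K'' (a * b) = K'' a * ε₃ b + ε₁ a * K'' b)
    (hK''gen : ∀ x : S,
      K'' (FreeAlgebra.ι k x) = (d (r x) : k) * K (FreeAlgebra.ι k x)) :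
    ∀ x : S,
      (d (c x) : k) * ε₁ (FreeAlgebra.ι k x) + (d (r x) : k) * ε₃ (FreeAlgebra.ι k x) =
        K'' (D (FreeAlgebra.ι k x)) := by
  intro x
  have hspan : ∀ a ∈ Submodule.span k (linkMonomials k c r x), K'' a = (d (r x) : k) * K a := by
    intro a ha
    induction ha using Submodule.span_induction with
    | mem a ha =>
      obtain ⟨y, hy, hends, rfl⟩ := ha
      rcases hends with ⟨hne, -, hr⟩ | ⟨rfl, -⟩
      · cases y with
        | nil => exact absurd rfl hne
        | cons b t =>
          rw [twistedDerivation_word_of_dilation hε₂ hKtw hK''tw hK''gen b t hy, ← hr,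
            List.head_cons]
      · simp [FreeAlgebra.word, twistedDerivation_one ε₂ ε₃ K hKtw,
          twistedDerivation_one ε₁ ε₃ K'' hK''tw]
    | zero => simp
    | add a b _ _ ha hb => rw [map_add, map_add, ha, hb, mul_add]
    | smul t a _ ha => simp only [map_smul, smul_eq_mul, ha, mul_left_comm]
  have hne : (d (r x) : k) ≠ 0 := (d (r x)).ne_zero
  rw [hspan _ (hgraded x), ← hKhtp, hε₂]
  field_simp
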